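/- Conditional moment generating function of a difference of jointly Gaussian scalars (second formula of Theorem 1): let n ≥ 1 and let (X, Z₁, Z₂) : Ω → ℝⁿ × ℝ × ℝ be jointly Gaussian with μ_X := E[X], invertible Σ_XX := Cov(X), c_k := Cov(X, Z_k) ∈ ℝⁿ for k = 1, 2, and let a ∈ ℝ. Define the conditional means m_k(X) := E[Z_k] + ⟨Σ_XX^{-1} c_k, X − μ_X⟩ and the conditional covariance matrix S ∈ ℝ^{2×2} with entries S_{kl} := Cov(Z_k, Z_l) − c_kᵀ Σ_XX^{-1} c_l. Then exp(a(Z₁ − Z₂)) is integrable and, almost surely, E[ exp( a (Z₁ − Z₂) ) | σ(X) ] = exp( a (m₁(X) − m₂(X)) + (a²/2) · vᵀ S v ), where v := (1, −1)ᵀ. -/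

import Mathlib

open Matrix MeasureTheory ProbabilityTheory
open scoped NNReal

/-- Covariance of two real random variables. -/
noncomputable def cov {Ω : Type*} [MeasurableSpace Ω] (P : Measure Ω) (X Y : Ω → ℝ) : ℝ :=
  ∫ ω, (X ω - ∫ ω', X ω' ∂P) * (Y ω - ∫ ω', Y ω' ∂P) ∂P

/-- `(X, Z₁, Z₂)` is jointly Gaussian: the pushforward of the law under every linear
functional of the coordinates is a (possibly degenerate) one-dimensional Gaussian. -/
def IsJointGaussian2 {Ω : Type*} [MeasurableSpace Ω] {n : ℕ} (P : Measure Ω)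
    (X : Ω → Fin n → ℝ) (Z₁ Z₂ : Ω → ℝ) : Prop :=
  ∀ (b : Fin n → ℝ) (a₁ a₂ : ℝ), ∃ m : ℝ, ∃ v : ℝ≥0,
    Measure.map (fun ω => (∑ j, b j * X ω j) + a₁ * Z₁ ω + a₂ * Z₂ ω) P = gaussianReal m v

theorem cov_eq_covariance {Ω : Type*} [MeasurableSpace Ω] (P : Measure Ω) (X Y : Ω → ℝ) :
    cov P X Y = cov[X, Y; P] := rfl

theorem IsJointGaussian2.hasGaussianLaw {Ω : Type*} [MeasurableSpace Ω] {P : Measure Ω} {n : ℕ}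
    {X : Ω → Fin n → ℝ} {Z₁ Z₂ : Ω → ℝ} (h : IsJointGaussian2 P X Z₁ Z₂)
    (hX : Measurable X) (hZ₁ : Measurable Z₁) (hZ₂ : Measurable Z₂) :
    HasGaussianLaw (fun ω => (X ω, Z₁ ω, Z₂ ω)) P := by
  refine ⟨isGaussian_of_map_eq_gaussianReal fun L => ?_⟩
  obtain ⟨m, v, hmv⟩ := h (fun j => L (Pi.single j 1, 0, 0)) (L (0, 1, 0)) (L (0, 0, 1))
  refine ⟨m, v, ?_⟩
  rw [Measure.map_map (by fun_prop) (by fun_prop), ← hmv]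
  congr 1
  ext ω
  have hdecomp : (X ω, Z₁ ω, Z₂ ω) =
      (∑ j, X ω j • ((Pi.single j 1, 0, 0) : (Fin n → ℝ) × ℝ × ℝ)) +
        Z₁ ω • ((0, 1, 0) : (Fin n → ℝ) × ℝ × ℝ) + Z₂ ω • ((0, 0, 1) : (Fin n → ℝ) × ℝ × ℝ) := by
    refine Prod.ext ?_ (Prod.ext ?_ ?_)
    · ext i
      simp [Prod.fst_sum, Finset.sum_apply, Pi.single_apply]
    · simp [Prod.snd_sum]
    · simp [Prod.snd_sum]
  simp only [Function.comp_apply]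
  rw [hdecomp]
  simp only [map_add, map_sum, map_smul, smul_eq_mul, mul_comm]

/-- The moment generating function of a Gaussian variable. -/
theorem ProbabilityTheory.HasGaussianLaw.integral_exp_mul {Ω : Type*} [MeasurableSpace Ω] {P : Measure Ω}
    {Y : Ω → ℝ} (hY : HasGaussianLaw Y P) (a : ℝ) :
    ∫ ω, Real.exp (a * Y ω) ∂P = Real.exp (a * P[Y] + a ^ 2 / 2 * Var[Y; P]) := by
  have h := mgf_gaussianReal hY.map_eq_gaussianReal a
  rw [mgf, Real.coe_toNNReal _ (variance_nonneg _ _)] at h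
  rw [h]
  ring_nf

theorem ProbabilityTheory.HasGaussianLaw.integrable_exp_mul {Ω : Type*} [MeasurableSpace Ω] {P : Measure Ω}
    {Y : Ω → ℝ} (hY : HasGaussianLaw Y P) (a : ℝ) :
    Integrable (fun ω => Real.exp (a * Y ω)) P := by
  have := hY.isProbabilityMeasure
  rw [← mgf_pos_iff, mgf_gaussianReal hY.map_eq_gaussianReal]
  exact Real.exp_pos _

/-- Conditional moment generating function of `Y` given `X`, for `(X, Y)` jointly Gaussian and `w`
a vector of regression coefficients of `Y` on `X`. -/
theorem ProbabilityTheory.HasGaussianLaw.condExp_exp_mul {Ω ι : Type*} [MeasurableSpace Ω] [Fintype ι]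
    {P : Measure Ω} {X : Ω → ι → ℝ} {Y : Ω → ℝ} (hX : Measurable X) (hY : Measurable Y)
    (hXY : HasGaussianLaw (fun ω => (X ω, Y ω)) P) (w : ι → ℝ)
    (hw : ∀ i, ∑ j, cov[fun ω => X ω i, fun ω => X ω j; P] * w j = cov[fun ω => X ω i, Y; P])
    (a : ℝ) :
    P[fun ω => Real.exp (a * Y ω) | MeasurableSpace.comap X inferInstance] =ᵐ[P]
      fun ω => Real.exp (a * (P[Y] + ∑ j, w j * (X ω j - ∫ ω', X ω' j ∂P)) +
        a ^ 2 / 2 * (Var[Y; P] - ∑ j, w j * cov[fun ω => X ω j, Y; P])) := by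
  have := hXY.isProbabilityMeasure
  have hX2 : ∀ j, MemLp (fun ω => X ω j) 2 P := fun j =>
    (HasGaussianLaw.eval (X := fun j ω => X ω j) hXY.fst j).memLp_two
  have hwX2 : ∀ j, MemLp (fun ω => w j * X ω j) 2 P := fun j => (hX2 j).const_mul _
  have hY2 : MemLp Y 2 P := hXY.snd.memLp_two
  set R : Ω → ℝ := fun ω => Y ω - ∑ j, w j * X ω j with hR
  have hRm : Measurable R := by fun_prop
  have hXR : HasGaussianLaw (fun ω => (X ω, R ω)) P := by
    convert! hXY.map_fun ((ContinuousLinearMap.fst ℝ (ι → ℝ) ℝ).prod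
      (ContinuousLinearMap.snd ℝ (ι → ℝ) ℝ -
        ∑ j, w j • (ContinuousLinearMap.proj j).comp (ContinuousLinearMap.fst ℝ (ι → ℝ) ℝ)))
      using 2 with ω
    simp [hR]
  have hcovXR : ∀ i, cov[fun ω => X ω i, R; P] = 0 := by
    intro i
    rw [hR, covariance_fun_sub_right (hX2 i) hY2 (memLp_finsetSum _ fun j _ => hwX2 j),
      covariance_fun_sum_right hwX2 (hX2 i), ← hw i]
    simp only [covariance_const_mul_right]
    simp [mul_comm]
  have hindep : IndepFun X R P := by
    have hpi : HasGaussianLaw (fun ω => (fun j => X ω j, fun _ : Unit => R ω)) P := by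
      let L : (ι → ℝ) × ℝ →L[ℝ] (ι → ℝ) × (Unit → ℝ) :=
        (ContinuousLinearMap.fst ℝ (ι → ℝ) ℝ).prod
          (ContinuousLinearMap.pi fun _ => ContinuousLinearMap.snd ℝ (ι → ℝ) ℝ)
      exact hXR.map_fun L
    have h := HasGaussianLaw.indepFun_of_covariance_eval (P := P) (X := fun j ω => X ω j)
      (Y := fun _ : Unit => R) hpi (fun i _ => hcovXR i)
    exact h.comp measurable_id (measurable_pi_apply ())
  have hvar : Var[R; P] = Var[Y; P] - ∑ j, w j * cov[fun ω => X ω j, Y; P] := by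
    have hR2 : MemLp R 2 P := hXR.snd.memLp_two
    have hsum : MemLp (fun ω => ∑ j, w j * X ω j) 2 P := memLp_finsetSum _ fun j _ => hwX2 j
    have hRY : cov[R, R; P] = cov[Y, R; P] := by
      conv_lhs => rw [hR]
      rw [covariance_fun_sub_left hY2 hsum hR2, covariance_fun_sum_left hwX2 hR2]
      simp [covariance_const_mul_left, hcovXR]
    rw [← covariance_self hRm.aemeasurable, hRY, ← covariance_self hY.aemeasurable, hR,
      covariance_fun_sub_right hY2 hY2 hsum, covariance_comm Y (fun ω => ∑ j, w j * X ω j),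
      covariance_fun_sum_left hwX2 hY2]
    simp [covariance_const_mul_left]
  have hmean : P[R] = P[Y] - ∑ j, w j * ∫ ω, X ω j ∂P := by
    have hint : ∀ j, Integrable (fun ω => w j * X ω j) P := fun j =>
      (hwX2 j).integrable (by norm_num)
    rw [hR, integral_sub (hY2.integrable (by norm_num)) (integrable_finsetSum _ fun j _ => hint j),
      integral_finsetSum _ fun j _ => hint j]
    simp [integral_const_mul]
  have hsplit : (fun ω => Real.exp (a * Y ω)) =
      (fun ω => Real.exp (a * ∑ j, w j * X ω j)) * fun ω => Real.exp (a * R ω) := by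
    ext ω
    simp only [Pi.mul_apply, ← Real.exp_add, hR]
    ring_nf
  have hmeas : StronglyMeasurable[MeasurableSpace.comap X inferInstance]
      fun ω => Real.exp (a * ∑ j, w j * X ω j) := by
    have hg : Measurable fun x : ι → ℝ => Real.exp (a * ∑ j, w j * x j) := by fun_prop
    exact (hg.comp (comap_measurable X)).stronglyMeasurable
  have hmeasR : StronglyMeasurable[MeasurableSpace.comap R inferInstance]
      fun ω => Real.exp (a * R ω) := by
    have hg : Measurable fun x : ℝ => Real.exp (a * x) := by fun_prop
    exact (hg.comp (comap_measurable R)).stronglyMeasurable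
  have hpull := condExp_mul_of_stronglyMeasurable_left hmeas
    (hsplit ▸ hXY.snd.integrable_exp_mul a)
    (hXR.snd.integrable_exp_mul a)
  have hconst := condExp_indep_eq hRm.comap_le hX.comap_le hmeasR hindep.symm
  rw [hsplit]
  filter_upwards [hpull, hconst] with ω h₁ h₂
  rw [h₁, Pi.mul_apply, h₂, hXR.snd.integral_exp_mul, ← Real.exp_add, hvar, hmean]
  simp only [mul_sub, Finset.sum_sub_distrib]
  ring_nf

theorem stmt13 {Ω : Type*} [MeasurableSpace Ω] (P : Measure Ω) [IsProbabilityMeasure P]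
    {n : ℕ} (hn : 1 ≤ n) (X : Ω → Fin n → ℝ) (Z : Fin 2 → Ω → ℝ)
    (hmX : Measurable X) (hmZ : ∀ k, Measurable (Z k))
    (hGauss : IsJointGaussian2 P X (Z 0) (Z 1))
    (μX : Fin n → ℝ) (hμX : μX = fun j => ∫ ω, X ω j ∂P)
    (SigXX : Matrix (Fin n) (Fin n) ℝ)
    (hSigXX : SigXX = Matrix.of fun i j => cov P (fun ω => X ω i) (fun ω => X ω j))
    (hinv : IsUnit SigXX.det)
    (c : Fin 2 → Fin n → ℝ) (hc : c = fun k j => cov P (fun ω => X ω j) (Z k))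
    (a : ℝ)
    (m : Fin 2 → Ω → ℝ)
    (hm : m = fun k ω =>
      (∫ ω', Z k ω' ∂P) + ∑ j, SigXX⁻¹.mulVec (c k) j * (X ω j - μX j))
    (S : Matrix (Fin 2) (Fin 2) ℝ)
    (hS : S = Matrix.of fun k l => cov P (Z k) (Z l) - c k ⬝ᵥ SigXX⁻¹.mulVec (c l)) :
    Integrable (fun ω => Real.exp (a * (Z 0 ω - Z 1 ω))) P ∧
      P[fun ω => Real.exp (a * (Z 0 ω - Z 1 ω)) | MeasurableSpace.comap X inferInstance]
        =ᵐ[P]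
        fun ω => Real.exp (a * (m 0 ω - m 1 ω) +
          a ^ 2 / 2 * (![1, -1] ⬝ᵥ S.mulVec ![1, -1])) := by
  have hlaw := hGauss.hasGaussianLaw hmX (hmZ 0) (hmZ 1)
  have hXY : HasGaussianLaw (fun ω => (X ω, Z 0 ω - Z 1 ω)) P :=
    hlaw.map_fun ((ContinuousLinearMap.fst ℝ (Fin n → ℝ) (ℝ × ℝ)).prod
      ((ContinuousLinearMap.fst ℝ ℝ ℝ - ContinuousLinearMap.snd ℝ ℝ ℝ).comp
        (ContinuousLinearMap.snd ℝ (Fin n → ℝ) (ℝ × ℝ))))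
  have hmY : Measurable fun ω => Z 0 ω - Z 1 ω := (hmZ 0).sub (hmZ 1)
  have hX2 : ∀ j, MemLp (fun ω => X ω j) 2 P := fun j =>
    (HasGaussianLaw.eval (X := fun j ω => X ω j) hlaw.fst j).memLp_two
  have hZ2 : ∀ k, MemLp (Z k) 2 P :=
    Fin.forall_fin_two.2 ⟨hlaw.snd.fst.memLp_two, hlaw.snd.snd.memLp_two⟩
  refine ⟨hXY.snd.integrable_exp_mul a, ?_⟩
  have hcov : ∀ j, cov[fun ω => X ω j, fun ω => Z 0 ω - Z 1 ω; P] = (c 0 - c 1) j := by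
    intro j
    rw [covariance_fun_sub_right (hX2 j) (hZ2 0) (hZ2 1), hc]
    rfl
  have hreg : SigXX *ᵥ (SigXX⁻¹ *ᵥ (c 0 - c 1)) = c 0 - c 1 := by
    rw [mulVec_mulVec, mul_nonsing_inv _ hinv, one_mulVec]
  have hcond := hXY.condExp_exp_mul hmX hmY
    (SigXX⁻¹ *ᵥ (c 0 - c 1))
    (fun i => by
      rw [hcov]
      refine Eq.trans ?_ (congrFun hreg i)
      simp only [mulVec, dotProduct, hSigXX, of_apply, cov_eq_covariance]) a
  have hvar : Var[fun ω => Z 0 ω - Z 1 ω; P] =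
      cov P (Z 0) (Z 0) - cov P (Z 0) (Z 1) - (cov P (Z 1) (Z 0) - cov P (Z 1) (Z 1)) := by
    rw [← covariance_self hmY.aemeasurable,
      covariance_fun_sub_fun_sub (hZ2 0) (hZ2 1) (hZ2 0) (hZ2 1)]
    simp only [cov_eq_covariance]
    ring
  have hquad : (![1, -1] : Fin 2 → ℝ) ⬝ᵥ S.mulVec ![1, -1] =
      Var[fun ω => Z 0 ω - Z 1 ω; P] - (SigXX⁻¹ *ᵥ (c 0 - c 1)) ⬝ᵥ (c 0 - c 1) := by
    rw [hvar, dotProduct_comm (SigXX⁻¹ *ᵥ _), mulVec_sub, sub_dotProduct, dotProduct_sub,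
      dotProduct_sub]
    simp only [hS, mulVec, dotProduct, Fin.sum_univ_two, of_apply, cons_val_zero, cons_val_one]
    ring
  have hmean : ∀ ω, m 0 ω - m 1 ω = (∫ ω', (Z 0 ω' - Z 1 ω') ∂P) +
      ∑ j, (SigXX⁻¹ *ᵥ (c 0 - c 1)) j * (X ω j - ∫ ω', X ω' j ∂P) := by
    intro ω
    rw [integral_sub ((hZ2 0).integrable (by norm_num)) ((hZ2 1).integrable (by norm_num)),
      mulVec_sub]
    simp only [hm, hμX, Pi.sub_apply, sub_mul, Finset.sum_sub_distrib]
    ring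
  filter_upwards [hcond] with ω hω
  rw [hω, hmean, hquad]
  simp only [hcov, dotProduct]
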